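/- Assume the standard setup with r ≥ 2, and suppose c_{j−1} ≤ e < c_j for some 3 ≤ j ≤ r. Let 1 ≤ i ≤ j − 1 and assume e + s·nᵢ ≥ c_r, where s ≥ 1 if nᵢ = 1 and s ≥ 2 is even if nᵢ ≥ 2. If Vᵢ contains no pendant vertex, then s·nᵢ + t − r + b + 1 ≤ χ_la(G(Vᵢ,s)) ≤ s·nᵢ + t − r + j − 1. -/

import Mathlib

open Finset
open scoped Classical

namespace LocalAntimagic

variable {V : Type*}

/-- The induced vertex label: sum of the labels of edges incident to `v`. -/
noncomputable def vertexSum [Fintype V] (G : SimpleGraph V) (f : Sym2 V → ℕ) (v : V) : ℕ :=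
  ∑ e ∈ G.incidenceFinset v, f e

/-- `f` is a local antimagic labeling of `G`: a bijection from the edge set onto
`{1, …, |E|}` whose induced vertex labels distinguish adjacent vertices. -/
def IsLocalAntimagic [Fintype V] (G : SimpleGraph V) (f : Sym2 V → ℕ) : Prop :=
  Set.BijOn f G.edgeSet (Set.Icc 1 G.edgeFinset.card) ∧
  ∀ ⦃u v : V⦄, G.Adj u v → vertexSum G f u ≠ vertexSum G f v

/-- The color number `c(f)`: the number of distinct induced vertex labels. -/
noncomputable def colorCount [Fintype V] (G : SimpleGraph V) (f : Sym2 V → ℕ) : ℕ :=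
  (Finset.univ.image (vertexSum G f)).card

/-- The local antimagic chromatic number. -/
noncomputable def chiLA [Fintype V] (G : SimpleGraph V) : ℕ :=
  sInf {n | ∃ f, IsLocalAntimagic G f ∧ colorCount G f = n}

/-- A pendant vertex is a vertex of degree 1. -/
def IsPendant [Fintype V] (G : SimpleGraph V) (v : V) : Prop :=
  G.degree v = 1

/-- The number of pendant vertices of `G`. -/
noncomputable def pendantCount [Fintype V] (G : SimpleGraph V) : ℕ :=
  (Finset.univ.filter (fun v => IsPendant G v)).card

/-- `G(S, s)`: the graph obtained from `G` by attaching `s` new pendant edges to every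
vertex of `S`.  The new pendant vertex attached to `w ∈ S` via the `j`-th new edge is
`Sum.inr (w, j)`; the original graph lives on the `Sum.inl` vertices. -/
def attachPendants (G : SimpleGraph V) (S : Finset V) (s : ℕ) :
    SimpleGraph (V ⊕ (S × Fin s)) :=
  SimpleGraph.fromRel (fun a b =>
    (∃ u v : V, a = Sum.inl u ∧ b = Sum.inl v ∧ G.Adj u v) ∨
    (∃ (w : S) (j : Fin s), a = Sum.inl (w : V) ∧ b = Sum.inr (w, j)))

/-- The standard setup: `G` is a connected graph with at least `2` edges and
`χ_la(G) = t ≥ 2`; `f` is a local antimagic labeling of `G` with `c(f) = t` whose color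
classes are `Vset 1, …, Vset t` (each nonempty, with `f⁺ ≡ c i` on `Vset i`, and the
colors `c 1, …, c t` pairwise distinct); every non-pendant vertex lies in
`Vset 1 ∪ ⋯ ∪ Vset r` where `1 ≤ r ≤ t`; each `Vset i` with `r + 1 ≤ i ≤ t` is a
singleton consisting of a pendant vertex; `c 1 < c 2 < ⋯ < c r` and
`c (r+1) < c (r+2) < ⋯ < c t`. -/
structure StandardSetup [Fintype V] (G : SimpleGraph V) (f : Sym2 V → ℕ)
    (t r : ℕ) (Vset : ℕ → Finset V) (c : ℕ → ℕ) : Prop where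
  connected : G.Connected
  two_le_card_edges : 2 ≤ G.edgeFinset.card
  chiLA_eq : chiLA G = t
  two_le_t : 2 ≤ t
  antimagic : IsLocalAntimagic G f
  colorCount_eq : colorCount G f = t
  color_on_class : ∀ i ∈ Finset.Icc 1 t, ∀ v ∈ Vset i, vertexSum G f v = c i
  class_cover : ∀ v : V, ∃ i ∈ Finset.Icc 1 t, v ∈ Vset i
  class_nonempty : ∀ i ∈ Finset.Icc 1 t, (Vset i).Nonempty
  color_injective : ∀ i ∈ Finset.Icc 1 t, ∀ j ∈ Finset.Icc 1 t, i ≠ j → c i ≠ c j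
  one_le_r : 1 ≤ r
  r_le_t : r ≤ t
  nonpendant_mem : ∀ v : V, ¬ IsPendant G v → ∃ i ∈ Finset.Icc 1 r, v ∈ Vset i
  pendant_singleton : ∀ i ∈ Finset.Icc (r + 1) t, ∃ v : V, IsPendant G v ∧ Vset i = {v}
  c_strictMono_low : ∀ i j : ℕ, 1 ≤ i → i < j → j ≤ r → c i < c j
  c_strictMono_high : ∀ i j : ℕ, r + 1 ≤ i → i < j → j ≤ t → c i < c j

/-- `b`: the number of pendant vertices of `G` lying in `Vset 1 ∪ ⋯ ∪ Vset r`. -/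
noncomputable def pendantsInLow [Fintype V] (G : SimpleGraph V)
    (Vset : ℕ → Finset V) (r : ℕ) : ℕ :=
  (((Finset.Icc 1 r).biUnion Vset).filter (fun v => IsPendant G v)).card

theorem vertexSum_eq_sum_ite [Fintype V] (G : SimpleGraph V) (f : Sym2 V → ℕ) (v : V) :
    vertexSum G f v = ∑ u, if G.Adj v u then f s(v, u) else 0 := by
  rw [← Finset.sum_filter, vertexSum]
  symm
  refine Finset.sum_bij (fun u _ => s(v, u)) ?_ ?_ ?_ ?_
  · intro u hu
    simpa [SimpleGraph.mem_incidenceFinset, SimpleGraph.incidenceSet] using hu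
  · intro a _ b _ h
    exact Sym2.congr_right.mp h
  · intro x hx
    rw [SimpleGraph.mem_incidenceFinset] at hx
    obtain ⟨hx, hv⟩ := hx
    obtain ⟨u, rfl⟩ := hv
    exact ⟨u, by simpa using hx, rfl⟩
  · intros; rfl

theorem vertexSum_one [Fintype V] (G : SimpleGraph V) (v : V) :
    vertexSum G (fun _ => 1) v = G.degree v := by
  simp [vertexSum]

theorem le_vertexSum_of_adj [Fintype V] {G : SimpleGraph V} {u v : V} (f : Sym2 V → ℕ)
    (h : G.Adj u v) : f s(u, v) ≤ vertexSum G f u := by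
  rw [vertexSum_eq_sum_ite]
  calc f s(u, v) = if G.Adj u v then f s(u, v) else 0 := by rw [if_pos h]
    _ ≤ _ := Finset.single_le_sum (f := fun w => if G.Adj u w then f s(u, w) else 0)
      (fun _ _ => Nat.zero_le _) (Finset.mem_univ v)

theorem IsPendant.eq_of_adj [Fintype V] {G : SimpleGraph V} {u v w : V} (hu : IsPendant G u)
    (hv : G.Adj u v) (hw : G.Adj u w) : v = w := by
  have h : (G.neighborFinset u).card = 1 := hu
  exact Finset.card_le_one.mp h.le v (by simpa using hv) w (by simpa using hw)

theorem IsPendant.exists_adj [Fintype V] {G : SimpleGraph V} {u : V} (hu : IsPendant G u) :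
    ∃ v, G.Adj u v :=
  (G.degree_pos_iff_exists_adj u).mp (by rw [hu]; exact one_pos)

theorem IsPendant.vertexSum_eq [Fintype V] {G : SimpleGraph V} {u v : V} (f : Sym2 V → ℕ)
    (hu : IsPendant G u) (h : G.Adj u v) : vertexSum G f u = f s(u, v) := by
  rw [vertexSum_eq_sum_ite, Finset.sum_eq_single v]
  · rw [if_pos h]
  · intro w _ hw
    exact if_neg fun h' => hw (hu.eq_of_adj h' h)
  · simp

theorem lt_vertexSum_of_adj [Fintype V] {G : SimpleGraph V} {f : Sym2 V → ℕ} {u v : V}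
    (hpos : ∀ x ∈ G.edgeSet, 0 < f x) (hu : ¬ IsPendant G u) (h : G.Adj u v) :
    f s(u, v) < vertexSum G f u := by
  have hdeg : 1 < (G.neighborFinset u).card := by
    have h1 : 0 < G.degree u := (G.degree_pos_iff_exists_adj u).mpr ⟨v, h⟩
    have h2 : G.degree u ≠ 1 := hu
    change 1 < G.degree u
    omega
  obtain ⟨w, hw, hwv⟩ := Finset.exists_mem_ne hdeg v
  rw [SimpleGraph.mem_neighborFinset] at hw
  have hle : ∑ x ∈ {v, w}, (if G.Adj u x then f s(u, x) else 0) ≤ vertexSum G f u := by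
    rw [vertexSum_eq_sum_ite]
    exact Finset.sum_le_sum_of_subset (Finset.subset_univ _)
  rw [Finset.sum_pair hwv.symm, if_pos h, if_pos hw] at hle
  have := hpos s(u, w) hw
  omega

/-- In a connected graph with at least two edges, no edge joins two pendant vertices. -/
theorem not_isPendant_of_adj [Fintype V] {G : SimpleGraph V} (hG : G.Connected)
    (he : 2 ≤ G.edgeFinset.card) {u v : V} (h : G.Adj u v) (hu : IsPendant G u) :
    ¬ IsPendant G v := by
  intro hv
  have hclosed : ∀ x y, G.Adj x y → x = u ∨ x = v → y = u ∨ y = v := by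
    rintro x y hxy (rfl | rfl)
    · exact Or.inr (hu.eq_of_adj hxy h)
    · exact Or.inl (hv.eq_of_adj hxy h.symm)
  have hall : ∀ x, x = u ∨ x = v := by
    intro x
    obtain ⟨p⟩ := hG.preconnected u x
    suffices H : ∀ a b, G.Walk a b → a = u ∨ a = v → b = u ∨ b = v from H u x p (Or.inl rfl)
    intro a b p
    induction p with
    | nil => exact id
    | cons hxy _ ih => exact fun hx => ih (hclosed _ _ hxy hx)
  have hsub : G.edgeFinset ⊆ {s(u, v)} := by
    intro x
    induction x with
    | _ x y =>
      intro hxy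
      rw [SimpleGraph.mem_edgeFinset, SimpleGraph.mem_edgeSet] at hxy
      have hne := hxy.ne
      rcases hall x with rfl | rfl <;> rcases hall y with rfl | rfl <;>
        simp_all [Sym2.eq_swap]
  have := Finset.card_le_card hsub
  simp at this
  omega

/-- Pendant vertices have pairwise distinct colors, and a non-pendant endpoint of the edge
with the largest label has a color exceeding all of them. -/
theorem pendantCount_lt_colorCount [Fintype V] {G : SimpleGraph V} {f : Sym2 V → ℕ}
    (hf : IsLocalAntimagic G f) (he : 0 < G.edgeFinset.card)
    (hG : ∀ u v, G.Adj u v → IsPendant G u → ¬ IsPendant G v) :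
    pendantCount G < colorCount G f := by
  obtain ⟨hbij, -⟩ := hf
  set q := G.edgeFinset.card
  have hpos : ∀ x ∈ G.edgeSet, 0 < f x := fun x hx => (hbij.mapsTo hx).1
  have htop : ∃ u, q < vertexSum G f u := by
    obtain ⟨x, hx, hxq⟩ := hbij.surjOn (show q ∈ Set.Icc 1 q from ⟨he, le_rfl⟩)
    induction x with
    | _ x y =>
      rw [SimpleGraph.mem_edgeSet] at hx
      by_cases hp : IsPendant G x
      · refine ⟨y, ?_⟩
        have := lt_vertexSum_of_adj hpos (hG _ _ hx hp) hx.symm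
        rwa [Sym2.eq_swap, hxq] at this
      · refine ⟨x, ?_⟩
        have := lt_vertexSum_of_adj hpos hp hx
        rwa [hxq] at this
  obtain ⟨z, hz⟩ := htop
  have hinj : Set.InjOn (vertexSum G f) (Finset.univ.filter (fun v => IsPendant G v)) := by
    intro u hu v hv huv
    simp only [Finset.coe_filter, Finset.mem_univ, true_and, Set.mem_ofPred_eq] at hu hv
    obtain ⟨u', hu'⟩ := hu.exists_adj
    obtain ⟨v', hv'⟩ := hv.exists_adj
    rw [hu.vertexSum_eq f hu', hv.vertexSum_eq f hv'] at huv
    have := hbij.injOn hu' hv' huv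
    rw [Sym2.eq_iff] at this
    rcases this with h | h
    · exact h.1
    · exact absurd (h.2.symm ▸ hv) (hG _ _ hu' hu)
  rw [pendantCount, ← Finset.card_image_of_injOn hinj, colorCount]
  refine Finset.card_lt_card (Finset.ssubset_iff_of_subset
    (Finset.image_subset_image (Finset.filter_subset _ _)) |>.mpr
      ⟨vertexSum G f z, Finset.mem_image_of_mem _ (Finset.mem_univ z), ?_⟩)
  intro hmem
  obtain ⟨u, hu, huz⟩ := Finset.mem_image.mp hmem
  have hu := (Finset.mem_filter.mp hu).2
  obtain ⟨u', hu'⟩ := hu.exists_adj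
  have : f s(u, u') ≤ q := (hbij.mapsTo hu').2
  rw [hu.vertexSum_eq f hu'] at huz
  omega

section AttachPendants

variable {G : SimpleGraph V} {S : Finset V} {s : ℕ}

@[simp]
theorem attachPendants_adj_inl_inl {u v : V} :
    (attachPendants G S s).Adj (Sum.inl u) (Sum.inl v) ↔ G.Adj u v := by
  simp only [attachPendants, SimpleGraph.fromRel_adj]
  constructor
  · rintro ⟨-, h⟩
    simpa [G.adj_comm v u] using h
  · intro h
    refine ⟨by simpa using h.ne, ?_⟩
    simpa [G.adj_comm v u] using h

@[simp]
theorem attachPendants_adj_inl_inr {u : V} {p : S × Fin s} :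
    (attachPendants G S s).Adj (Sum.inl u) (Sum.inr p) ↔ u = p.1 := by
  obtain ⟨⟨w, hw⟩, k⟩ := p
  simp only [attachPendants, SimpleGraph.fromRel_adj]
  simp

@[simp]
theorem attachPendants_adj_inr_inl {u : V} {p : S × Fin s} :
    (attachPendants G S s).Adj (Sum.inr p) (Sum.inl u) ↔ u = p.1 := by
  rw [SimpleGraph.adj_comm, attachPendants_adj_inl_inr]

@[simp]
theorem not_attachPendants_adj_inr_inr {p p' : S × Fin s} :
    ¬ (attachPendants G S s).Adj (Sum.inr p) (Sum.inr p') := by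
  simp [attachPendants]

/-- The edge joining the new pendant vertex `p` to the vertex it is attached to. -/
def pendantEdge (p : S × Fin s) : Sym2 (V ⊕ (S × Fin s)) := s(Sum.inl p.1, Sum.inr p)

theorem pendantEdge_injective : Function.Injective (pendantEdge (S := S) (s := s)) := by
  intro p p' h
  have h : p.1 = p'.1 ∧ p = p' := by simpa [pendantEdge] using h
  exact h.2

theorem pendantEdge_ne_map_inl (p : S × Fin s) (x : Sym2 V) :
    pendantEdge p ≠ x.map Sum.inl := by
  induction x with
  | _ a b => simp [pendantEdge]

theorem mem_edgeSet_attachPendants {x : Sym2 (V ⊕ (S × Fin s))} :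
    x ∈ (attachPendants G S s).edgeSet ↔
      (∃ y ∈ G.edgeSet, y.map Sum.inl = x) ∨ ∃ p, pendantEdge p = x := by
  constructor
  · induction x with
    | _ a b =>
      rw [SimpleGraph.mem_edgeSet]
      rcases a with a | p <;> rcases b with b | p' <;> intro h
      · exact Or.inl ⟨s(a, b), by simpa using h, by simp⟩
      · exact Or.inr ⟨p', by simp_all [pendantEdge]⟩
      · exact Or.inr ⟨p, by simp_all [pendantEdge, Sym2.eq_swap]⟩
      · exact absurd h not_attachPendants_adj_inr_inr
  · rintro (⟨y, hy, rfl⟩ | ⟨p, rfl⟩)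
    · induction y with
      | _ a b => simpa using hy
    · simp [pendantEdge]

theorem card_edgeFinset_attachPendants [Fintype V] :
    (attachPendants G S s).edgeFinset.card = G.edgeFinset.card + s * S.card := by
  have h : (attachPendants G S s).edgeFinset =
      G.edgeFinset.image (Sym2.map Sum.inl) ∪ Finset.univ.image pendantEdge := by
    ext x
    simp only [SimpleGraph.mem_edgeFinset, mem_edgeSet_attachPendants, Finset.mem_union,
      Finset.mem_image, Finset.mem_univ, true_and]
  rw [h, Finset.card_union_of_disjoint, Finset.card_image_of_injective _
    (Sym2.map.injective Sum.inl_injective), Finset.card_image_of_injective _ pendantEdge_injective]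
  · simp [mul_comm]
  · rw [Finset.disjoint_left]
    intro x hx hx'
    obtain ⟨y, -, rfl⟩ := Finset.mem_image.mp hx
    obtain ⟨p, -, hp⟩ := Finset.mem_image.mp hx'
    exact pendantEdge_ne_map_inl p y hp

theorem vertexSum_attachPendants_inr [Fintype V] (g : Sym2 (V ⊕ (S × Fin s)) → ℕ)
    (p : S × Fin s) : vertexSum (attachPendants G S s) g (Sum.inr p) = g (pendantEdge p) := by
  rw [vertexSum_eq_sum_ite, Fintype.sum_sum_type]
  simp [pendantEdge, Sym2.eq_swap]

theorem vertexSum_attachPendants_inl [Fintype V] (g : Sym2 (V ⊕ (S × Fin s)) → ℕ) (v : V) :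
    vertexSum (attachPendants G S s) g (Sum.inl v) =
      vertexSum G (fun x => g (x.map Sum.inl)) v +
        if h : v ∈ S then ∑ k, g (pendantEdge (⟨v, h⟩, k)) else 0 := by
  rw [vertexSum_eq_sum_ite, vertexSum_eq_sum_ite, Fintype.sum_sum_type]
  simp only [attachPendants_adj_inl_inl, attachPendants_adj_inl_inr, Sym2.map_mk]
  congr 1
  rw [Fintype.sum_prod_type]
  split_ifs with h
  · rw [Finset.sum_eq_single ⟨v, h⟩]
    · simp [pendantEdge]
    · intro w _ hw
      refine Finset.sum_eq_zero fun k _ => if_neg fun hv => hw (Subtype.ext hv.symm)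
    · simp
  · refine Finset.sum_eq_zero fun w _ => Finset.sum_eq_zero fun k _ => if_neg ?_
    rintro rfl
    exact h w.2

theorem degree_attachPendants_inl [Fintype V] (v : V) :
    (attachPendants G S s).degree (Sum.inl v) = G.degree v + if v ∈ S then s else 0 := by
  rw [← vertexSum_one, vertexSum_attachPendants_inl, vertexSum_one]
  simp

theorem isPendant_attachPendants_inr [Fintype V] (p : S × Fin s) :
    IsPendant (attachPendants G S s) (Sum.inr p) := by
  rw [IsPendant, ← vertexSum_one, vertexSum_attachPendants_inr]

theorem pendantCount_attachPendants_ge [Fintype V] (hS : ∀ v ∈ S, ¬ IsPendant G v) :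
    s * S.card + pendantCount G ≤ pendantCount (attachPendants G S s) := by
  have hsub : (Finset.univ.filter fun v => IsPendant G v).disjSum Finset.univ ⊆
      Finset.univ.filter fun x => IsPendant (attachPendants G S s) x := by
    rintro (v | p) hx
    · have hv : IsPendant G v := by simpa using hx
      have hvS : v ∉ S := fun h => hS v h hv
      rw [Finset.mem_filter_univ, IsPendant, degree_attachPendants_inl, if_neg hvS, add_zero]
      exact hv
    · simp [isPendant_attachPendants_inr]
  have := Finset.card_le_card hsub
  rw [Finset.card_disjSum] at this
  simp only [Finset.card_univ, Fintype.card_prod, Fintype.card_coe, Fintype.card_fin] at this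
  rw [pendantCount, pendantCount, mul_comm]
  omega

theorem not_isPendant_of_attachPendants_adj [Fintype V] (hG : G.Connected)
    (he : 2 ≤ G.edgeFinset.card) (hs : 1 ≤ s) (hS : ∀ v ∈ S, 0 < G.degree v)
    (x y : V ⊕ (S × Fin s)) (h : (attachPendants G S s).Adj x y)
    (hx : IsPendant (attachPendants G S s) x) : ¬ IsPendant (attachPendants G S s) y := by
  have hdeg (w : S) : ¬ IsPendant (attachPendants G S s) (Sum.inl (w : V)) := by
    have := hS w w.2
    rw [IsPendant, degree_attachPendants_inl, if_pos w.2]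
    omega
  have hpend (v v' : V) (hv : G.Adj v v') (hp : IsPendant (attachPendants G S s) (Sum.inl v)) :
      IsPendant G v := by
    have := (G.degree_pos_iff_exists_adj v).mpr ⟨v', hv⟩
    rw [IsPendant, degree_attachPendants_inl] at hp
    rw [IsPendant]
    omega
  rcases x with u | p <;> rcases y with v | p'
  · rw [attachPendants_adj_inl_inl] at h
    exact fun hy => not_isPendant_of_adj hG he h (hpend _ _ h hx) (hpend _ _ h.symm hy)
  · rw [attachPendants_adj_inl_inr] at h
    subst h
    exact absurd hx (hdeg _)
  · rw [attachPendants_adj_inr_inl] at h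
    subst h
    exact hdeg _
  · exact absurd h not_attachPendants_adj_inr_inr

/-- The labeling of `G(S, s)` extending the labeling `f` of `G` by the labels `h` of the new
pendant edges. -/
noncomputable def extendLabeling (f : Sym2 V → ℕ) (h : S × Fin s → ℕ) :
    Sym2 (V ⊕ (S × Fin s)) → ℕ :=
  Function.extend (Sym2.map Sum.inl) f (Function.extend pendantEdge h 0)

@[simp]
theorem extendLabeling_map_inl (f : Sym2 V → ℕ) (h : S × Fin s → ℕ) (x : Sym2 V) :
    extendLabeling f h (x.map Sum.inl) = f x :=
  (Sym2.map.injective Sum.inl_injective).extend_apply _ _ _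

@[simp]
theorem extendLabeling_pendantEdge (f : Sym2 V → ℕ) (h : S × Fin s → ℕ) (p : S × Fin s) :
    extendLabeling f h (pendantEdge p) = h p := by
  rw [extendLabeling, Function.extend_apply', pendantEdge_injective.extend_apply]
  rintro ⟨x, hx⟩
  exact pendantEdge_ne_map_inl p x hx.symm

theorem bijOn_extendLabeling [Fintype V] {f : Sym2 V → ℕ} {h : S × Fin s → ℕ}
    (hf : Set.BijOn f G.edgeSet (Set.Icc 1 G.edgeFinset.card)) (hinj : Function.Injective h)
    (hmem : ∀ p, h p ∈ Finset.Icc (G.edgeFinset.card + 1) (G.edgeFinset.card + s * S.card)) :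
    Set.BijOn (extendLabeling f h) (attachPendants G S s).edgeSet
      (Set.Icc 1 (attachPendants G S s).edgeFinset.card) := by
  have hmaps : Set.MapsTo (extendLabeling f h) (attachPendants G S s).edgeFinset
      (Finset.Icc 1 (attachPendants G S s).edgeFinset.card) := by
    intro x hx
    rw [SimpleGraph.coe_edgeFinset, mem_edgeSet_attachPendants] at hx
    rw [card_edgeFinset_attachPendants, Finset.coe_Icc]
    rcases hx with ⟨y, hy, rfl⟩ | ⟨p, rfl⟩
    · rw [extendLabeling_map_inl]
      have := hf.mapsTo hy
      exact ⟨this.1, this.2.trans (Nat.le_add_right _ _)⟩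
    · rw [extendLabeling_pendantEdge]
      have := Finset.mem_Icc.mp (hmem p)
      exact ⟨by omega, this.2⟩
  have hinj' : Set.InjOn (extendLabeling f h) (attachPendants G S s).edgeFinset := by
    intro x hx x' hx' hxx'
    rw [SimpleGraph.coe_edgeFinset, mem_edgeSet_attachPendants] at hx hx'
    rcases hx with ⟨y, hy, rfl⟩ | ⟨p, rfl⟩ <;> rcases hx' with ⟨y', hy', rfl⟩ | ⟨p', rfl⟩ <;>
      simp only [extendLabeling_map_inl, extendLabeling_pendantEdge] at hxx'
    · rw [hf.injOn hy hy' hxx']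
    · have := (hf.mapsTo hy).2
      have := (Finset.mem_Icc.mp (hmem p')).1
      omega
    · have := (hf.mapsTo hy').2
      have := (Finset.mem_Icc.mp (hmem p)).1
      omega
    · rw [hinj hxx']
  have hsurj := Finset.surjOn_of_injOn_of_card_le _ hmaps hinj' (by simp)
  simpa using Set.BijOn.mk hmaps hinj' hsurj

end AttachPendants

/-- The entry in row `k` of the column `x` of the array filled row by row with
`a + 1, a + 2, …`, each row having `n` entries, where odd rows are filled backwards. -/
def snake (a n k x : ℕ) : ℕ := a + 1 + k * n + if Even k then x else n - 1 - x

theorem snake_injective {a n k x k' x' : ℕ} (hx : x < n) (hx' : x' < n)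
    (h : snake a n k x = snake a n k' x') : k = k' ∧ x = x' := by
  have key : ∀ {k x : ℕ}, x < n → (if Even k then x else n - 1 - x) < n := by
    intro k x hx
    split_ifs <;> omega
  have hk : k = k' := by
    have h₁ := key (k := k) hx
    have h₂ := key (k := k') hx'
    unfold snake at h
    generalize (if Even k then x else n - 1 - x) = y at *
    generalize (if Even k' then x' else n - 1 - x') = y' at *
    by_contra hne
    rcases Nat.lt_or_gt_of_ne hne with hlt | hlt
    · have := Nat.mul_le_mul_right n (Nat.succ_le_of_lt hlt)
      rw [Nat.succ_mul] at this
      omega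
    · have := Nat.mul_le_mul_right n (Nat.succ_le_of_lt hlt)
      rw [Nat.succ_mul] at this
      omega
  subst hk
  refine ⟨rfl, ?_⟩
  unfold snake at h
  split_ifs at h <;> omega

theorem snake_mem_Icc {a n s k x : ℕ} (hk : k < s) (hx : x < n) :
    snake a n k x ∈ Finset.Icc (a + 1) (a + s * n) := by
  have := Nat.mul_le_mul_right n (Nat.succ_le_of_lt hk)
  rw [Nat.succ_mul] at this
  rw [Finset.mem_Icc, snake]
  split_ifs <;> omega

theorem snake_column_sum {a n s x : ℕ} (hx : x < n) (h : n = 1 ∨ Even s) :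
    ∑ k ∈ Finset.range s, snake a n k x = ∑ k ∈ Finset.range s, snake a n k 0 := by
  rcases h with rfl | ⟨m, rfl⟩
  · rw [Nat.lt_one_iff.mp hx]
  · induction m with
    | zero => simp
    | succ m ih =>
      have h₁ : Even (m + m) := ⟨m, rfl⟩
      have h₂ : ¬ Even (m + m + 1) := by simp [Nat.even_add_one, h₁]
      rw [show m + 1 + (m + 1) = m + m + 1 + 1 by ring, Finset.sum_range_succ,
        Finset.sum_range_succ, Finset.sum_range_succ, Finset.sum_range_succ, ih]
      simp only [snake, h₁, h₂, if_true, if_false]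
      omega

theorem le_snake_column_sum {a n s : ℕ} (hn : 0 < n) (hs : 1 ≤ s) (h : n = 1 ∨ Even s) :
    a + s * n ≤ ∑ k ∈ Finset.range s, snake a n k 0 := by
  obtain ⟨s, rfl⟩ : ∃ s', s = s' + 1 := ⟨s - 1, by omega⟩
  rw [Finset.sum_range_succ, Nat.succ_mul]
  refine le_trans ?_ (Nat.le_add_left _ _)
  rcases h with rfl | h
  · simp [snake]; omega
  · have h' : ¬ Even s := by simpa [Nat.even_add_one] using h
    simp only [snake, h', if_false]
    omega

/-- The labels `a + 1, …, a + s * |S|` can be distributed over the `s` new pendant edges at each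
vertex of `S` such that all the sums at the vertices of `S` agree. -/
theorem exists_balanced_labels {S : Finset V} {s : ℕ} (a : ℕ) (hS : S.Nonempty) (hs : 1 ≤ s)
    (h : S.card = 1 ∨ Even s) :
    ∃ (l : S × Fin s → ℕ) (T : ℕ), Function.Injective l ∧
      (∀ p, l p ∈ Finset.Icc (a + 1) (a + s * S.card)) ∧ (∀ w, ∑ k, l (w, k) = T) ∧
      a + s * S.card ≤ T := by
  refine ⟨fun p => snake a S.card p.2 (S.equivFin p.1),
    ∑ k ∈ Finset.range s, snake a S.card k 0, ?_, ?_, ?_, le_snake_column_sum hS.card_pos hs h⟩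
  · rintro ⟨w, k⟩ ⟨w', k'⟩ hp
    obtain ⟨hk, hw⟩ := snake_injective (S.equivFin w).2 (S.equivFin w').2 hp
    exact Prod.ext (S.equivFin.injective (Fin.ext hw)) (Fin.ext hk)
  · exact fun p => snake_mem_Icc p.2.2 (S.equivFin p.1).2
  · intro w
    rw [← snake_column_sum (S.equivFin w).2 h,
      Fin.sum_univ_eq_sum_range (fun k => snake a S.card k (S.equivFin w))]

namespace StandardSetup

variable [Fintype V] {G : SimpleGraph V} {f : Sym2 V → ℕ} {t r : ℕ} {Vset : ℕ → Finset V}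
  {c : ℕ → ℕ}

theorem degree_pos (setup : StandardSetup G f t r Vset c) (v : V) : 0 < G.degree v := by
  have : Nontrivial V := by
    obtain ⟨x, hx⟩ := Finset.card_pos.mp (two_pos.trans_le setup.two_le_card_edges)
    induction x with
    | _ x y => exact ⟨x, y, (SimpleGraph.mem_edgeFinset.mp hx).ne⟩
  exact setup.connected.preconnected.degree_pos_of_nontrivial v

theorem vertexSum_pos (setup : StandardSetup G f t r Vset c) (v : V) : 0 < vertexSum G f v := by
  obtain ⟨u, hu⟩ := (G.degree_pos_iff_exists_adj v).mp (setup.degree_pos v)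
  exact lt_of_lt_of_le (setup.antimagic.1.mapsTo hu).1 (le_vertexSum_of_adj f hu)

theorem eq_of_mem (setup : StandardSetup G f t r Vset c) {k l : ℕ} (hk : k ∈ Finset.Icc 1 t)
    (hl : l ∈ Finset.Icc 1 t) {v : V} (hvk : v ∈ Vset k) (hvl : v ∈ Vset l) : k = l := by
  by_contra hne
  exact setup.color_injective k hk l hl hne
    ((setup.color_on_class k hk v hvk).symm.trans (setup.color_on_class l hl v hvl))

/-- The colors of the singleton pendant classes are edge labels. -/
theorem color_le_of_lt (setup : StandardSetup G f t r Vset c) {k : ℕ}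
    (hk : k ∈ Finset.Icc (r + 1) t) : c k ≤ G.edgeFinset.card := by
  obtain ⟨v, hv, hvk⟩ := setup.pendant_singleton k hk
  obtain ⟨u, hu⟩ := hv.exists_adj
  have hk' := Finset.mem_Icc.mp hk
  rw [← setup.color_on_class k (Finset.mem_Icc.mpr ⟨by omega, hk'.2⟩) v (by simp [hvk]),
    hv.vertexSum_eq f hu]
  exact (setup.antimagic.1.mapsTo hu).2

theorem le_pendantCount (setup : StandardSetup G f t r Vset c) :
    (t - r) + pendantsInLow G Vset r ≤ pendantCount G := by
  have hrt := setup.r_le_t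
  have hdisj : Set.PairwiseDisjoint (Finset.Icc (r + 1) t : Set ℕ) Vset := by
    intro k hk l hl hkl
    simp only [Finset.coe_Icc, Set.mem_Icc] at hk hl
    rw [Function.onFun, Finset.disjoint_left]
    intro v hvk hvl
    exact hkl (setup.eq_of_mem (Finset.mem_Icc.mpr ⟨by omega, hk.2⟩)
      (Finset.mem_Icc.mpr ⟨by omega, hl.2⟩) hvk hvl)
  have hcard : ((Finset.Icc (r + 1) t).biUnion Vset).card = t - r := by
    rw [Finset.card_biUnion hdisj, Finset.sum_congr rfl (g := fun _ => 1)]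
    · simp
    · intro k hk
      obtain ⟨v, -, hv⟩ := setup.pendant_singleton k hk
      rw [hv, Finset.card_singleton]
  rw [← hcard, pendantsInLow, pendantCount, ← Finset.card_union_of_disjoint]
  · refine Finset.card_le_card (Finset.union_subset ?_ ?_)
    · intro v hv
      obtain ⟨k, hk, hvk⟩ := Finset.mem_biUnion.mp hv
      obtain ⟨u, hu, huk⟩ := setup.pendant_singleton k hk
      rw [huk, Finset.mem_singleton] at hvk
      subst hvk
      simpa using hu
    · exact Finset.filter_subset_filter _ (Finset.subset_univ _)
  · rw [Finset.disjoint_left]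
    intro v hv hv'
    obtain ⟨k, hk, hvk⟩ := Finset.mem_biUnion.mp hv
    obtain ⟨l, hl, hvl⟩ := Finset.mem_biUnion.mp (Finset.mem_filter.mp hv').1
    rw [Finset.mem_Icc] at hk hl
    have := setup.eq_of_mem (Finset.mem_Icc.mpr ⟨by omega, hk.2⟩)
      (Finset.mem_Icc.mpr ⟨by omega, by omega⟩) hvk hvl
    omega

end StandardSetup

/-- Theorem 2.1(3)(b): in the standard setup with `r ≥ 2`, if
`c_{j-1} ≤ e < c_j` for some `3 ≤ j ≤ r`, and `1 ≤ i ≤ j - 1` with `e + s·nᵢ ≥ c_r`,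
where `s ≥ 1` if `nᵢ = 1` and `s ≥ 2` is even if `nᵢ ≥ 2`, and `Vᵢ` contains no pendant
vertex, then `s·nᵢ + t - r + b + 1 ≤ χ_la(G(Vᵢ, s)) ≤ s·nᵢ + t - r + j - 1`. -/
theorem chiLA_attachPendants_bounds_nonpendant_class [Fintype V] (G : SimpleGraph V)
    (f : Sym2 V → ℕ) (t r : ℕ) (Vset : ℕ → Finset V) (c : ℕ → ℕ)
    (setup : StandardSetup G f t r Vset c) (hr : 2 ≤ r)
    (e s i j b : ℕ) (he : G.edgeFinset.card = e)
    (hb : pendantsInLow G Vset r = b)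
    (hj₁ : 3 ≤ j) (hj₂ : j ≤ r)
    (hce₁ : c (j - 1) ≤ e) (hce₂ : e < c j)
    (hi₁ : 1 ≤ i) (hi₂ : i ≤ j - 1)
    (hbig : c r ≤ e + s * (Vset i).card)
    (hs₁ : (Vset i).card = 1 → 1 ≤ s)
    (hs₂ : 2 ≤ (Vset i).card → 2 ≤ s ∧ Even s)
    (hpend : ∀ v ∈ Vset i, ¬ IsPendant G v) :
    s * (Vset i).card + (t - r) + b + 1 ≤ chiLA (attachPendants G (Vset i) s) ∧
    chiLA (attachPendants G (Vset i) s) ≤ s * (Vset i).card + (t - r) + (j - 1) := by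
  subst he hb
  have hrt := setup.r_le_t
  have hit : i ∈ Finset.Icc 1 t := Finset.mem_Icc.mpr ⟨hi₁, by omega⟩
  set S := Vset i
  have hSne : S.Nonempty := setup.class_nonempty i hit
  have hs : 1 ≤ s ∧ (S.card = 1 ∨ Even s) := by
    rcases Nat.lt_or_ge 1 S.card with h | h
    · exact ⟨by have := (hs₂ h).1; omega, Or.inr (hs₂ h).2⟩
    · have h1 : S.card = 1 := le_antisymm h hSne.card_pos
      exact ⟨hs₁ h1, Or.inl h1⟩
  obtain ⟨hs1, hs⟩ := hs
  obtain ⟨l, T, hinj, hmem, hT, hle⟩ := exists_balanced_labels G.edgeFinset.card hSne hs1 hs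
  set g := extendLabeling f l with hg
  have hci : 0 < c i := by
    obtain ⟨v, hv⟩ := hSne
    rw [← setup.color_on_class i hit v hv]
    exact setup.vertexSum_pos v
  have hinr : ∀ p, vertexSum (attachPendants G S s) g (Sum.inr p) = l p := fun p => by
    rw [vertexSum_attachPendants_inr, hg, extendLabeling_pendantEdge]
  have hmemS : ∀ v ∈ S, vertexSum (attachPendants G S s) g (Sum.inl v) = c i + T := by
    intro v hv
    rw [vertexSum_attachPendants_inl, dif_pos hv]
    simp only [hg, extendLabeling_map_inl, extendLabeling_pendantEdge]
    rw [hT, setup.color_on_class i hit v hv]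
  have hnmemS : ∀ v ∉ S, vertexSum (attachPendants G S s) g (Sum.inl v) = vertexSum G f v := by
    intro v hv
    rw [vertexSum_attachPendants_inl, dif_neg hv]
    simp only [hg, extendLabeling_map_inl, add_zero]
  have hcle : ∀ k ∈ Finset.Icc 1 t, c k ≤ G.edgeFinset.card + s * S.card := by
    intro k hk
    rw [Finset.mem_Icc] at hk
    rcases Nat.lt_trichotomy k r with h | rfl | h
    · exact (setup.c_strictMono_low k r hk.1 h le_rfl).le.trans hbig
    · exact hbig
    · exact (setup.color_le_of_lt (Finset.mem_Icc.mpr ⟨h, hk.2⟩)).trans (Nat.le_add_right _ _)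
  have hlt : ∀ v, vertexSum G f v < c i + T := by
    intro v
    obtain ⟨k, hk, hv⟩ := setup.class_cover v
    have := hcle k hk
    rw [setup.color_on_class k hk v hv]
    omega
  have hlt' : ∀ p, l p < c i + T := by
    intro p
    have := (Finset.mem_Icc.mp (hmem p)).2
    omega
  have hganti : IsLocalAntimagic (attachPendants G S s) g := by
    refine ⟨bijOn_extendLabeling setup.antimagic.1 hinj hmem, ?_⟩
    rintro (u | p) (v | p') huv
    · rw [attachPendants_adj_inl_inl] at huv
      have hne := setup.antimagic.2 huv
      by_cases hu : u ∈ S <;> by_cases hv : v ∈ S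
      · exact absurd ((setup.color_on_class i hit u hu).trans
          (setup.color_on_class i hit v hv).symm) hne
      · rw [hmemS u hu, hnmemS v hv]
        exact (hlt v).ne'
      · rw [hnmemS u hu, hmemS v hv]
        exact (hlt u).ne
      · rwa [hnmemS u hu, hnmemS v hv]
    · rw [attachPendants_adj_inl_inr] at huv
      subst huv
      rw [hmemS _ p'.1.2, hinr]
      exact (hlt' p').ne'
    · rw [attachPendants_adj_inr_inl] at huv
      subst huv
      rw [hmemS _ p.1.2, hinr]
      exact (hlt' p).ne
    · exact absurd huv not_attachPendants_adj_inr_inr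
  have hcount : colorCount (attachPendants G S s) g ≤ s * S.card + (t - r) + (j - 1) := by
    have hsub : Finset.univ.image (vertexSum (attachPendants G S s) g) ⊆
        Finset.Icc (G.edgeFinset.card + 1) (G.edgeFinset.card + s * S.card) ∪
          (Finset.Icc (r + 1) t).image c ∪ insert (c i + T)
            (((Finset.Icc 1 (j - 1)).erase i).image c) := by
      intro x hx
      obtain ⟨y, -, rfl⟩ := Finset.mem_image.mp hx
      rcases y with v | p
      · by_cases hv : v ∈ S
        · rw [hmemS v hv]
          simp
        · rw [hnmemS v hv]
          obtain ⟨k, hk, hvk⟩ := setup.class_cover v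
          have hki : k ≠ i := by
            rintro rfl
            exact hv hvk
          rw [setup.color_on_class k hk v hvk]
          have hk' := Finset.mem_Icc.mp hk
          rcases Nat.lt_or_ge r k with hrk | hrk
          · exact Finset.mem_union_left _ (Finset.mem_union_right _
              (Finset.mem_image_of_mem _ (Finset.mem_Icc.mpr ⟨hrk, hk'.2⟩)))
          · rcases Nat.lt_or_ge k j with hkj | hkj
            · exact Finset.mem_union_right _ (Finset.mem_insert_of_mem
                (Finset.mem_image_of_mem _ (Finset.mem_erase.mpr
                  ⟨hki, Finset.mem_Icc.mpr ⟨hk'.1, by omega⟩⟩)))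
            · refine Finset.mem_union_left _ (Finset.mem_union_left _
                (Finset.mem_Icc.mpr ⟨?_, hcle k hk⟩))
              rcases hkj.eq_or_lt with rfl | hkj
              · exact hce₂
              · exact hce₂.trans (setup.c_strictMono_low j k (by omega) hkj hrk)
      · rw [hinr]
        exact Finset.mem_union_left _ (Finset.mem_union_left _ (hmem p))
    refine (Finset.card_le_card hsub).trans ((Finset.card_union_le _ _).trans
      (add_le_add ((Finset.card_union_le _ _).trans (add_le_add ?_ ?_)) ?_))
    · simp
    · exact Finset.card_image_le.trans (by simp)
    · refine (Finset.card_insert_le _ _).trans ?_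
      have := (Finset.card_image_le (s := (Finset.Icc 1 (j - 1)).erase i) (f := c))
      rw [Finset.card_erase_of_mem (Finset.mem_Icc.mpr ⟨hi₁, hi₂⟩), Nat.card_Icc] at this
      omega
  have hne : {n | ∃ g, IsLocalAntimagic (attachPendants G S s) g ∧
      colorCount (attachPendants G S s) g = n}.Nonempty := ⟨_, g, hganti, rfl⟩
  have hupper : chiLA (attachPendants G S s) ≤ colorCount (attachPendants G S s) g :=
    Nat.sInf_le ⟨g, hganti, rfl⟩
  refine ⟨le_csInf hne ?_, hupper.trans hcount⟩
  rintro _ ⟨g', hg', rfl⟩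
  have h₁ := pendantCount_lt_colorCount hg'
    (by have := setup.two_le_card_edges; rw [card_edgeFinset_attachPendants]; omega)
    (not_isPendant_of_attachPendants_adj setup.connected setup.two_le_card_edges hs1
      fun v _ => setup.degree_pos v)
  have h₂ := pendantCount_attachPendants_ge (s := s) hpend
  have h₃ := setup.le_pendantCount
  omega

end LocalAntimagic
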